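/- arXiv:1410.8780 — 3 statements merged into one kernel-verified Lean document; each statement's English description precedes it below -/
import Mathlib

section
/- Green's relation D is a congruence on any skew Heyting algebra (S;∧,∨,→,1): if a D c and b D d then (a∧b) D (c∧d), (a∨b) D (c∨d), and (a→b) D (c→d). -/
/-- A skew lattice: both operations idempotent, associative, with the four absorption laws. -/
structure SkewLattice (S : Type*) where
  m : S → S → S  -- meet ∧
  j : S → S → S  -- join ∨
  m_idem : ∀ x, m x x = x
  j_idem : ∀ x, j x x = x
  m_assoc : ∀ x y z, m (m x y) z = m x (m y z)
  j_assoc : ∀ x y z, j (j x y) z = j x (j y z)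
  abs1 : ∀ x y, m x (j x y) = x
  abs2 : ∀ x y, j x (m x y) = x
  abs3 : ∀ x y, j (m x y) y = y
  abs4 : ∀ x y, m (j x y) y = y

namespace SkewLattice

variable {S : Type*}

/-- Natural partial order: x ≤ y iff x∨y = y = y∨x. -/
def nle (L : SkewLattice S) (x y : S) : Prop := L.j x y = y ∧ L.j y x = y

/-- Natural preorder: x ⪯ y iff y∨x∨y = y. -/
def npre (L : SkewLattice S) (x y : S) : Prop := L.j (L.j y x) y = y

/-- Green's relation D: x D y iff x ⪯ y and y ⪯ x. -/
def dRel (L : SkewLattice S) (x y : S) : Prop := L.npre x y ∧ L.npre y x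

/-- Green's relation L. -/
def lRel (L : SkewLattice S) (x y : S) : Prop := L.m x y = x ∧ L.m y x = y

/-- Green's relation R. -/
def rRel (L : SkewLattice S) (x y : S) : Prop := L.m x y = y ∧ L.m y x = x

/-- Co-strong distributivity. -/
def CoStronglyDistributive (L : SkewLattice S) : Prop :=
  (∀ x y z, L.j x (L.m y z) = L.m (L.j x y) (L.j x z)) ∧
  (∀ x y z, L.j (L.m x y) z = L.m (L.j x z) (L.j y z))

/-- Conormality: x∨y∨z∨w = x∨z∨y∨w. -/
def Conormal (L : SkewLattice S) : Prop :=
  ∀ x y z w, L.j (L.j (L.j x y) z) w = L.j (L.j (L.j x z) y) w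

/-- t is a top: x∨t = t = t∨x for all x. -/
def IsTop (L : SkewLattice S) (t : S) : Prop := ∀ x, L.j x t = t ∧ L.j t x = t

/-- `h` is a skew Heyting implication for the skew lattice `L`:
(i) x→y = (y∨x∨y)→y, and (ii) whenever y ≤ x, x→y is the greatest element w
of the upset y↑ satisfying w∧x ≤ y. -/
def IsSkewHeytingImp (L : SkewLattice S) (h : S → S → S) : Prop :=
  (∀ x y, h x y = h (L.j (L.j y x) y) y) ∧
  (∀ x y, L.nle y x →
     L.nle y (h x y) ∧ L.nle (L.m (h x y) x) y ∧
     ∀ w, L.nle y w → L.nle (L.m w x) y → L.nle w (h x y))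

end SkewLattice

open SkewLattice

/-- A skew Heyting algebra: a co-strongly distributive skew lattice with top 1 together
with an implication satisfying (i) and (ii) above. -/
structure SkewHeytingAlgebra (S : Type*) extends SkewLattice S where
  himp : S → S → S
  one : S
  costrong : toSkewLattice.CoStronglyDistributive
  top : toSkewLattice.IsTop one
  himp_spec : toSkewLattice.IsSkewHeytingImp himp

section Band

variable {S : Type*} {f : S → S → S}

/-- In a band, an element with factor `x` absorbs `x`: if `e = u x v` then `e x e = e`. -/
theorem band_sandwich_of_factor (hi : ∀ x, f x x = x) (ha : ∀ x y z, f (f x y) z = f x (f y z))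
    {e u x v : S} (he : e = f (f u x) v) : f (f e x) e = e := by
  have hq : f (f e x) (f (f x v) e) = e := by
    calc f (f e x) (f (f x v) e)
        = f (f u (f (f x v) (f (f x x) v))) e := by simp only [he, ha]
      _ = f e e := by rw [hi x, hi (f x v), ← ha, ← he]
      _ = e := hi e
  calc f (f e x) e = f (f e x) (f (f e x) (f (f x v) e)) := by rw [hq]
    _ = e := by rw [← ha, hi, hq]

/-- In a band, if `z` absorbs both `x` and `y`, then it absorbs their product. -/
theorem band_sandwich_mul (hi : ∀ x, f x x = x) (ha : ∀ x y z, f (f x y) z = f x (f y z))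
    {x y z : S} (hx : f (f z x) z = z) (hy : f (f z y) z = z) : f (f z (f x y)) z = z := by
  have h : z = f (f (f (f z y) z) (f x y)) (f (f z x) z) := by
    calc z = f (f (f (f z y) z) x) z := by rw [hy, hx]
      _ = f (f z (f (f y z) x)) z := by simp only [ha]
      _ = f (f z (f (f (f y z) x) (f (f y z) x))) z := by rw [hi (f (f y z) x)]
      _ = f (f (f (f z y) z) (f x y)) (f (f z x) z) := by simp only [ha]
  exact band_sandwich_of_factor hi ha h

/-- In a band, absorption is transitive. -/
theorem band_sandwich_trans (hi : ∀ x, f x x = x) (ha : ∀ x y z, f (f x y) z = f x (f y z))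
    {x y z : S} (hxy : f (f y x) y = y) (hyz : f (f z y) z = z) : f (f z x) z = z := by
  have h : z = f (f (f z y) x) (f y z) := by
    calc z = f (f z (f (f y x) y)) z := by rw [hxy, hyz]
      _ = f (f (f z y) x) (f y z) := by simp only [ha]
  exact band_sandwich_of_factor hi ha h

end Band

namespace SkewLattice

variable {S : Type*} (L : SkewLattice S) {x y z w : S}

theorem j_eq_right_iff : L.j x y = y ↔ L.m x y = x :=
  ⟨fun h => by rw [← h, L.abs1], fun h => by rw [← h, L.abs3]⟩

theorem j_eq_left_iff : L.j x y = x ↔ L.m x y = y := by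
  refine ⟨fun h => ?_, fun h => ?_⟩
  · have := L.abs4 x y
    rwa [h] at this
  · have := L.abs2 x y
    rwa [h] at this

/-- The natural preorder in terms of the meet. -/
theorem npre_iff_meet : L.npre x y ↔ L.m (L.m x y) x = x := by
  refine ⟨fun h => ?_, fun h => ?_⟩
  · have h' : L.m y (L.j x y) = L.j x y := L.j_eq_left_iff.1 (by rw [← L.j_assoc]; exact h)
    exact band_sandwich_of_factor (v := L.j x y) L.m_idem L.m_assoc
      (by rw [L.m_assoc, h', L.abs1])
  · have h' : L.j x (L.m y x) = L.m y x := by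
      have h1 : L.m x (L.m y x) = x := by rw [← L.m_assoc]; exact h
      exact L.j_eq_right_iff.2 h1
    exact band_sandwich_of_factor (v := L.m y x) L.j_idem L.j_assoc
      (by rw [L.j_assoc, h', L.abs2])

variable {L}

theorem npre.trans (h : L.npre x y) (h' : L.npre y z) : L.npre x z :=
  band_sandwich_trans L.j_idem L.j_assoc h h'

theorem npre_j_left : L.npre x (L.j x y) := by
  unfold npre
  rw [L.j_assoc, ← L.j_assoc x x, L.j_idem, L.j_idem]

theorem npre_j_right : L.npre y (L.j x y) := by
  unfold npre
  rw [L.j_assoc x, L.j_idem, L.j_idem]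

theorem j_npre (hx : L.npre x z) (hy : L.npre y z) : L.npre (L.j x y) z :=
  band_sandwich_mul L.j_idem L.j_assoc hx hy

theorem m_npre_left : L.npre (L.m x y) x := by
  rw [npre_iff_meet]
  exact band_sandwich_of_factor (u := x) (v := y) L.m_idem L.m_assoc (by rw [L.m_idem])

theorem m_npre_right : L.npre (L.m x y) y := by
  rw [npre_iff_meet]
  exact band_sandwich_of_factor (u := x) (v := y) L.m_idem L.m_assoc
    (by rw [L.m_assoc, L.m_idem])

theorem npre_m (hx : L.npre z x) (hy : L.npre z y) : L.npre z (L.m x y) := by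
  rw [npre_iff_meet] at *
  exact band_sandwich_mul L.m_idem L.m_assoc hx hy

theorem m_npre_m (hx : L.npre x z) (hy : L.npre y w) : L.npre (L.m x y) (L.m z w) :=
  npre_m (m_npre_left.trans hx) (m_npre_right.trans hy)

theorem j_npre_j (hx : L.npre x z) (hy : L.npre y w) : L.npre (L.j x y) (L.j z w) :=
  j_npre (hx.trans npre_j_left) (hy.trans npre_j_right)

theorem nle.npre (h : L.nle x y) : L.npre x y := by
  unfold SkewLattice.npre
  rw [h.2, L.j_idem]

theorem npre_refl : L.npre x x :=
  nle.npre ⟨L.j_idem x, L.j_idem x⟩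

theorem nle_sandwich (x y : S) : L.nle y (L.j (L.j y x) y) := by
  refine ⟨?_, by rw [L.j_assoc, L.j_idem]⟩
  rw [← L.j_assoc, ← L.j_assoc, L.j_idem]

theorem nle_m (hx : L.nle z x) (hy : L.nle z y) : L.nle z (L.m x y) := by
  refine ⟨L.j_eq_right_iff.2 ?_, L.j_eq_left_iff.2 ?_⟩
  · rw [← L.m_assoc, L.j_eq_right_iff.1 hx.1, L.j_eq_right_iff.1 hy.1]
  · rw [L.m_assoc, L.j_eq_left_iff.1 hy.2, L.j_eq_left_iff.1 hx.2]

theorem nle.eq_of_npre (h : L.nle x y) (h' : L.npre y x) : y = x := by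
  unfold SkewLattice.npre at h'
  rwa [h.1, h.2] at h'

end SkewLattice

/-- The implication of a skew Heyting algebra is antitone in its first argument for the
natural preorder, also when its second argument is moved within a `D`-class. -/
theorem SkewHeytingAlgebra.himp_npre_himp {S : Type*} (A : SkewHeytingAlgebra S) {a b c d : S}
    (hca : A.npre c a) (hbd : A.dRel b d) : A.npre (A.himp a b) (A.himp c d) := by
  rw [A.himp_spec.1 a b, A.himp_spec.1 c d]
  obtain ⟨hb, hm, -⟩ := A.himp_spec.2 _ _ (nle_sandwich a b)
  obtain ⟨-, -, hmax⟩ := A.himp_spec.2 _ _ (nle_sandwich c d)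
  set a' := A.j (A.j b a) b
  set c' := A.j (A.j d c) d
  set h := A.himp a' b
  have hc' : A.npre c' a' := j_npre_j (j_npre_j hbd.2 hca) hbd.2
  have hd : A.nle d (A.j (A.j d h) d) := nle_sandwich h d
  have hdb : A.npre d h := hbd.2.trans hb.npre
  have hmeet : A.npre (A.m (A.j (A.j d h) d) c') d :=
    (m_npre_m (j_npre (j_npre hdb npre_refl) hdb) hc').trans (hm.npre.trans hbd.1)
  have heq : A.m (A.j (A.j d h) d) c' = d :=
    (nle_m hd (nle_sandwich c d)).eq_of_npre hmeet
  have hle : A.nle (A.m (A.j (A.j d h) d) c') d := by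
    rw [heq]
    exact ⟨A.j_idem d, A.j_idem d⟩
  exact (npre_j_right.trans npre_j_left).trans (hmax _ hd hle).npre

/-- Green's relation D is a congruence on any skew Heyting algebra. -/
theorem stmt_9 {S : Type*} (A : SkewHeytingAlgebra S) (a b c d : S)
    (hac : A.toSkewLattice.dRel a c) (hbd : A.toSkewLattice.dRel b d) :
    A.toSkewLattice.dRel (A.m a b) (A.m c d) ∧
    A.toSkewLattice.dRel (A.j a b) (A.j c d) ∧
    A.toSkewLattice.dRel (A.himp a b) (A.himp c d) := by
  exact ⟨⟨m_npre_m hac.1 hbd.1, m_npre_m hac.2 hbd.2⟩,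
    ⟨j_npre_j hac.1 hbd.1, j_npre_j hac.2 hbd.2⟩,
    A.himp_npre_himp hac.2 hbd, A.himp_npre_himp hac.1 hbd.symm⟩
end

section
/- Let S be a co-strongly distributive skew lattice and let b, d ∈ S with b D d. Then the map φ(x) = d∨x∨d is a lattice isomorphism from the upset b↑ = {x : b ≤ x} onto the upset d↑ = {y : d ≤ y}, with inverse ψ(y) = b∨y∨b. Precisely, for all x, x' with b ≤ x and b ≤ x', and all y with d ≤ y: d ≤ d∨x∨d; b∨(d∨x∨d)∨b = x; d∨(b∨y∨b)∨d = y; d∨(x∧x')∨d = (d∨x∨d)∧(d∨x'∨d); and d∨(x∨x')∨d = (d∨x∨d)∨(d∨x'∨d). -/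
open SkewLattice

namespace SkewLattice

variable {S : Type*} (L : SkewLattice S)

theorem j_idem_left (x z : S) : L.j x (L.j x z) = L.j x z := by
  rw [← L.j_assoc, L.j_idem]

theorem npre_join_middle (r y t : S) : L.npre y (L.j r (L.j y t)) := by
  generalize hp : L.j r (L.j y t) = p
  have key : L.j p (L.j r (L.j y p)) = p := by
    calc L.j p (L.j r (L.j y p))
        = L.j (L.j (L.j p (L.j r y)) (L.j p (L.j r y))) t := by
          have h : p = L.j p (L.j r (L.j y t)) := by rw [hp, L.j_idem]
          conv_lhs => rw [h]
          simp only [L.j_assoc, hp, L.j_idem]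
      _ = p := by rw [L.j_idem]; simp only [L.j_assoc, hp, L.j_idem]
  have hyp : L.j y p = L.j (L.j y p) (L.j y p) := (L.j_idem _).symm
  unfold npre
  calc L.j (L.j p y) p = L.j (L.j p (L.j r (L.j y p))) (L.j y p) := by rw [key, L.j_assoc]
    _ = L.j p (L.j r (L.j (L.j y p) (L.j y p))) := by simp only [L.j_assoc]
    _ = p := by rw [L.j_idem, key]

variable {L}

theorem npre.join {x y p : S} (hx : L.npre x p) (hy : L.npre y p) : L.npre (L.j x y) p := by
  unfold npre at *
  have h : L.j p (L.j (L.j y (L.j p x)) p) = p := by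
    calc _ = L.j (L.j (L.j p y) p) (L.j x p) := by simp only [L.j_assoc]
      _ = p := by rw [hy, ← L.j_assoc, hx]
  calc L.j (L.j p (L.j x y)) p
      = L.j (L.j (L.j (L.j p y) p) (L.j x y)) (L.j (L.j p x) p) := by rw [hx, hy]
    _ = L.j p (L.j (L.j (L.j y (L.j p x)) (L.j y (L.j p x))) p) := by simp only [L.j_assoc]
    _ = p := by rw [L.j_idem, h]

theorem nle_join_sandwich (a x : S) : L.nle a (L.j a (L.j x a)) := by
  constructor <;> simp only [L.j_assoc, j_idem_left, L.j_idem]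

theorem nle.m_eq_left {a p : S} (h : L.nle a p) : L.m a p = a := by
  rw [← h.1, L.abs1]

theorem nle.m_eq_right {a p : S} (h : L.nle a p) : L.m p a = a := by
  rw [← h.2, L.abs4]

/-- In a co-strongly distributive skew lattice, each upset of the natural partial order
meets every `D`-class in at most one point. -/
theorem CoStronglyDistributive.eq_of_dRel (hcs : L.CoStronglyDistributive) {a p q : S}
    (hp : L.nle a p) (hq : L.nle a q) (h : L.dRel p q) : p = q := by
  have key : ∀ {p q : S}, L.nle a p → L.nle a q → L.npre q p → L.j p q = p ∧ L.j q p = p := by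
    intro p q hp hq hqp
    have h₁ : L.m (L.j p q) p = p := by
      have h := hcs.1 p q a
      rwa [hq.m_eq_right, hp.2, eq_comm] at h
    have h₂ : L.m p (L.j q p) = p := by
      have h := hcs.2 a q p
      rwa [hq.m_eq_left, hp.1, eq_comm] at h
    constructor
    · have h := L.abs2 (L.j p q) p
      rw [h₁, hqp] at h
      exact h.symm
    · have h := L.abs3 p (L.j q p)
      rw [h₂, ← L.j_assoc, hqp] at h
      exact h.symm
  exact (key hp hq h.2).1.symm.trans (key hq hp h.1).2

theorem CoStronglyDistributive.join_regular (hcs : L.CoStronglyDistributive) (a u v : S) :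
    L.j a (L.j u (L.j a (L.j v a))) = L.j a (L.j u (L.j v a)) := by
  have hp : L.nle a (L.j a (L.j u (L.j a (L.j v a)))) := by
    simpa only [L.j_assoc] using nle_join_sandwich (L := L) a (L.j u (L.j a v))
  have hq : L.nle a (L.j a (L.j u (L.j v a))) := by
    simpa only [L.j_assoc] using nle_join_sandwich (L := L) a (L.j u v)
  have npre_of_nle : ∀ {p : S}, L.nle a p → L.npre a p := fun {p} h => by
    rw [npre, h.2, L.j_idem]
  refine hcs.eq_of_dRel hp hq ⟨?_, ?_⟩
  · have ha := npre_of_nle hq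
    have hu := L.npre_join_middle a u (L.j v a)
    have hv : L.npre v (L.j a (L.j u (L.j v a))) := by
      simpa only [L.j_assoc] using L.npre_join_middle (L.j a u) v a
    exact ha.join (hu.join (ha.join (hv.join ha)))
  · have ha := npre_of_nle hp
    have hu := L.npre_join_middle a u (L.j a (L.j v a))
    have hv : L.npre v (L.j a (L.j u (L.j a (L.j v a)))) := by
      simpa only [L.j_assoc] using L.npre_join_middle (L.j a (L.j u a)) v a
    exact ha.join (hu.join (hv.join ha))

theorem sandwich_sandwich {b d x : S} (hdb : L.npre d b) (hx : L.nle b x) :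
    L.j (L.j b (L.j (L.j d x) d)) b = x := by
  calc L.j (L.j b (L.j (L.j d x) d)) b
      = L.j (L.j b (L.j (L.j d (L.j b (L.j x b))) d)) b := by rw [hx.2, hx.1]
    _ = L.j (L.j (L.j b d) b) (L.j x (L.j (L.j b d) b)) := by simp only [L.j_assoc]
    _ = x := by rw [hdb, hx.2, hx.1]

end SkewLattice

/-- for b D d in a co-strongly distributive skew lattice,
φ(x) = d∨x∨d is a lattice isomorphism b↑ → d↑ with inverse ψ(y) = b∨y∨b. -/
theorem stmt_10 {S : Type*} (L : SkewLattice S) (hcs : L.CoStronglyDistributive)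
    (b d : S) (hbd : L.dRel b d) (x x' y : S)
    (hx : L.nle b x) (hx' : L.nle b x') (hy : L.nle d y) :
    L.nle d (L.j (L.j d x) d) ∧
    L.j (L.j b (L.j (L.j d x) d)) b = x ∧
    L.j (L.j d (L.j (L.j b y) b)) d = y ∧
    L.j (L.j d (L.m x x')) d = L.m (L.j (L.j d x) d) (L.j (L.j d x') d) ∧
    L.j (L.j d (L.j x x')) d = L.j (L.j (L.j d x) d) (L.j (L.j d x') d) := by
  refine ⟨?_, sandwich_sandwich hbd.2 hx, sandwich_sandwich hbd.1 hy, ?_, ?_⟩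
  · rw [L.j_assoc]
    exact nle_join_sandwich d x
  · rw [hcs.1, hcs.2]
  · simpa only [L.j_assoc, j_idem_left] using (hcs.join_regular d x x').symm
end

section
/- Let (S;∧,∨,1) be a co-strongly distributive skew lattice with top 1. Then there exists a binary operation → on S making (S;∧,∨,→,1) a skew Heyting algebra if and only if for all y, z ∈ S there exists m ∈ S such that m∧y ⪯ z and, for every x ∈ S, x∧y ⪯ z implies x ⪯ m. (The latter condition says exactly that the maximal lattice image S/D is a generalized Heyting algebra.) -/
open SkewLattice

namespace SkewLattice

variable {S : Type*}

lemma j_eq_right_of_m_eq_left (L : SkewLattice S) {x y : S} (h : L.m x y = x) :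
    L.j x y = y := by
  rw [← h, L.abs3]

lemma j_eq_left_of_m_eq_right (L : SkewLattice S) {x y : S} (h : L.m x y = y) :
    L.j x y = x := by
  rw [← h, L.abs2]

/-- Joins commute in every upset of a co-strongly distributive skew lattice. -/
lemma CoStronglyDistributive.j_comm_of_nle {L : SkewLattice S} (hcs : L.CoStronglyDistributive)
    {y u v : S} (hu : L.nle y u) (hv : L.nle y v) : L.j u v = L.j v u := by
  have m_yu : L.m y u = y := by rw [← hu.1, L.abs1]
  have m_uy : L.m u y = y := by
    have := L.abs4 u y
    rwa [hu.2] at this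
  have h₁ : L.m v (L.j u v) = v := by
    have := hcs.2 y u v
    rw [m_yu, hv.1] at this
    exact this.symm
  have h₂ : L.m (L.j v u) v = v := by
    have := hcs.1 v u y
    rw [m_uy, hv.2] at this
    exact this.symm
  calc L.j u v = L.j v (L.j u v) := (L.j_eq_right_of_m_eq_left h₁).symm
    _ = L.j (L.j v u) v := (L.j_assoc _ _ _).symm
    _ = L.j v u := L.j_eq_left_of_m_eq_right h₂

/-- Conjugation by `y` with respect to the join preserves meets. -/
lemma CoStronglyDistributive.j_m_j {L : SkewLattice S} (hcs : L.CoStronglyDistributive)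
    (y a b : S) :
    L.j (L.j y (L.m a b)) y = L.m (L.j (L.j y a) y) (L.j (L.j y b) y) := by
  rw [hcs.1, hcs.2]

lemma nle_j_j (L : SkewLattice S) (y t : S) : L.nle y (L.j (L.j y t) y) := by
  constructor
  · rw [← L.j_assoc, ← L.j_assoc, L.j_idem]
  · rw [L.j_assoc, L.j_idem]

lemma j_j_eq_of_nle (L : SkewLattice S) {y w : S} (h : L.nle y w) :
    L.j (L.j y w) y = w := by
  rw [h.1, h.2]

lemma nle_refl (L : SkewLattice S) (x : S) : L.nle x x := ⟨L.j_idem x, L.j_idem x⟩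

lemma npre_of_nle (L : SkewLattice S) {x y : S} (h : L.nle x y) : L.npre x y := by
  rw [npre, h.2, L.j_idem]

/-- Above `y`, the preorder relation `w ⪯ t` yields `w ≤ y ∨ t ∨ y`. -/
lemma CoStronglyDistributive.nle_j_j_of_npre {L : SkewLattice S}
    (hcs : L.CoStronglyDistributive) {y w t : S} (hyw : L.nle y w) (hwt : L.npre w t) :
    L.nle w (L.j (L.j y t) y) := by
  have comm := hcs.j_comm_of_nle hyw (L.nle_j_j y t)
  have key : L.j (L.j (L.j y t) y) w = L.j (L.j y t) y := by
    have hp : L.j (L.j (L.j y t) y) w = L.j (L.j y t) w := by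
      rw [L.j_assoc (L.j y t), hyw.1]
    calc L.j (L.j (L.j y t) y) w
        = L.j (L.j (L.j (L.j y t) y) w) (L.j (L.j y t) y) := by
          rw [← comm, L.j_assoc w, L.j_idem]
      _ = L.j (L.j (L.j y t) (L.j w y)) (L.j t y) := by
          rw [hp]; simp only [L.j_assoc]
      _ = L.j (L.j y (L.j (L.j t w) t)) y := by
          rw [hyw.2]; simp only [L.j_assoc]
      _ = L.j (L.j y t) y := by rw [hwt]
  exact ⟨comm.trans key, key⟩

end SkewLattice

/-- a co-strongly distributive skew lattice with top admits a skew
Heyting implication iff its maximal lattice image is a generalized Heyting algebra,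
i.e. for all y,z there is t with t∧y ⪯ z which is ⪯-greatest such. -/
theorem stmt_12 {S : Type*} (L : SkewLattice S) (one : S)
    (hcs : L.CoStronglyDistributive) (htop : L.IsTop one) :
    (∃ h : S → S → S, L.IsSkewHeytingImp h) ↔
    (∀ y z : S, ∃ t : S, L.npre (L.m t y) z ∧
      ∀ x : S, L.npre (L.m x y) z → L.npre x t) := by
  constructor
  · rintro ⟨h, h_conj, h_max⟩ y z
    have hzY := L.nle_j_j z y
    obtain ⟨hzt, hle, hgreatest⟩ := h_max _ z hzY
    rw [← h_conj] at hzt hle hgreatest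
    refine ⟨h y z, ?_, fun x hx => ?_⟩
    · have e : L.j (L.j z (L.m (h y z) y)) z = L.m (h y z) (L.j (L.j z y) z) := by
        rw [hcs.j_m_j, L.j_j_eq_of_nle hzt]
      rw [← e] at hle
      exact (L.nle_j_j z _).1.symm.trans hle.2
    · have e : L.m (L.j (L.j z x) z) (L.j (L.j z y) z) = z := by
        rw [← hcs.j_m_j]
        exact hx
      have hW := L.npre_of_nle (hgreatest _ (L.nle_j_j z x) (by rw [e]; exact L.nle_refl z))
      calc L.j (L.j (h y z) x) (h y z)
          = L.j (L.j (L.j (h y z) z) x) (L.j z (h y z)) := by rw [hzt.1, hzt.2]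
        _ = L.j (L.j (h y z) (L.j (L.j z x) z)) (h y z) := by simp only [L.j_assoc]
        _ = h y z := hW
  · intro H
    choose f hf hmax using H
    refine ⟨fun x y => L.j (L.j y (f (L.j (L.j y x) y) y)) y, fun x y => ?_, fun x y hyx => ?_⟩
    · dsimp only
      rw [L.j_j_eq_of_nle (L.nle_j_j y x)]
    · dsimp only
      rw [L.j_j_eq_of_nle hyx]
      refine ⟨L.nle_j_j _ _, ?_, fun w hyw hw => ?_⟩
      · have e : L.m (L.j (L.j y (f x y)) y) x = y := by
          have := hcs.j_m_j y (f x y) x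
          rw [L.j_j_eq_of_nle hyx] at this
          exact this.symm.trans (hf x y)
        rw [e]
        exact L.nle_refl y
      · exact hcs.nle_j_j_of_npre hyw (hmax x y w (L.npre_of_nle hw))
end
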